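/- arXiv:1703.05688 — 3 statements merged into one kernel-verified Lean document; each statement's English description precedes it below -/
import Mathlib

section
/- For multi-indices α, β, α', β' ∈ ℕ^n with (α, β) ≠ (α', β'), the functions f_{α,β} = b^α (z^β exp(−(π/2) Σ_{i=1}^n |z_i|²)) and f_{α',β'} = b^{α'} (z^{β'} exp(−(π/2) Σ_{i=1}^n |z_i|²)) are orthogonal in L²(ℂ^n; ℂ): ∫_{ℂ^n} f_{α,β}(Z) · conj(f_{α',β'}(Z)) dZ = 0. -/
open MeasureTheory Complex

noncomputable section

/-- The Wirtinger derivative `∂/∂z_j` of a function on `ℂⁿ ≅ ℝ^{2n}`. -/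
def wirtingerD {n : ℕ} (j : Fin n) (f : (Fin n → ℂ) → ℂ) (z : Fin n → ℂ) : ℂ :=
  (1 / 2) * (fderiv ℝ f z (Pi.single j 1) - Complex.I * fderiv ℝ f z (Pi.single j Complex.I))

/-- The Wirtinger derivative `∂/∂z̄_j` of a function on `ℂⁿ ≅ ℝ^{2n}`. -/
def wirtingerDBar {n : ℕ} (j : Fin n) (f : (Fin n → ℂ) → ℂ) (z : Fin n → ℂ) : ℂ :=
  (1 / 2) * (fderiv ℝ f z (Pi.single j 1) + Complex.I * fderiv ℝ f z (Pi.single j Complex.I))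

/-- The creation operator `b_j = -2 ∂/∂z_j + π z̄_j`. -/
def bOp {n : ℕ} (j : Fin n) (f : (Fin n → ℂ) → ℂ) : (Fin n → ℂ) → ℂ :=
  fun z => -2 * wirtingerD j f z + (Real.pi : ℂ) * (starRingEnd ℂ) (z j) * f z

/-- The annihilation operator `b_j⁺ = 2 ∂/∂z̄_j + π z_j`. -/
def bPlusOp {n : ℕ} (j : Fin n) (f : (Fin n → ℂ) → ℂ) : (Fin n → ℂ) → ℂ :=
  fun z => 2 * wirtingerDBar j f z + (Real.pi : ℂ) * z j * f z

/-- The Gaussian `exp(-(π/2) Σ |z_i|²)`. -/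
def gaussFn {n : ℕ} (z : Fin n → ℂ) : ℂ :=
  Complex.exp (-((Real.pi : ℂ) / 2) * ∑ i, (Complex.normSq (z i) : ℂ))

/-- The iterated operator `b^α = b_1^{α_1} ∘ ⋯ ∘ b_n^{α_n}`. -/
def bPow {n : ℕ} (α : Fin n → ℕ) (f : (Fin n → ℂ) → ℂ) : (Fin n → ℂ) → ℂ :=
  (List.ofFn (fun j : Fin n => (bOp j)^[α j])).foldr (· ∘ ·) id f

/-- The eigenfunctions `f_{α,β} = b^α (z^β exp(-(π/2) Σ |z_i|²))` of the model operator. -/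
def eigFun {n : ℕ} (α β : Fin n → ℕ) : (Fin n → ℂ) → ℂ :=
  bPow α (fun z => (∏ j, z j ^ β j) * gaussFn z)

/-- The model Bergman kernel `𝒫(z,w) = exp(-(π/2) Σ (|z_j|² + |w_j|² - 2 z_j w̄_j))`. -/
def bergK {n : ℕ} (z w : Fin n → ℂ) : ℂ :=
  Complex.exp (-((Real.pi : ℂ) / 2) *
    ∑ j, ((Complex.normSq (z j) : ℂ) + (Complex.normSq (w j) : ℂ)
            - 2 * z j * (starRingEnd ℂ) (w j)))

/-- `F : ℂⁿ × ℂⁿ → ℂ` is a polynomial function in the underlying real coordinates, equivalently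
a polynomial in the coordinates `z_i, z̄_i` of the first argument and `z'_i, z̄'_i` of the
second one. -/
def IsPolyKernel {n : ℕ} (F : (Fin n → ℂ) → (Fin n → ℂ) → ℂ) : Prop :=
  ∃ p : MvPolynomial (Fin n ⊕ Fin n ⊕ Fin n ⊕ Fin n) ℂ,
    ∀ z z' : Fin n → ℂ,
      F z z' = MvPolynomial.eval
        (Sum.elim (fun i => z i) (Sum.elim (fun i => (starRingEnd ℂ) (z i))
          (Sum.elim (fun i => z' i) (fun i => (starRingEnd ℂ) (z' i))))) p

/-- Under the identification `ℝ^{2n} ≅ ℂⁿ`, `z_j = Z_{2j-1} + i Z_{2j}`, the direction in `ℂⁿ`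
corresponding to the `j`-th real coordinate `Z_j`. -/
def coordDir {n : ℕ} (j : Fin (2 * n)) : Fin n → ℂ :=
  Pi.single ⟨j.val / 2, by have := j.isLt; omega⟩ (if j.val % 2 = 0 then 1 else Complex.I)

/-- The `j`-th real coordinate of `w ∈ ℂⁿ ≅ ℝ^{2n}`, viewed as a complex number. -/
def realCoordC {n : ℕ} (j : Fin (2 * n)) (w : Fin n → ℂ) : ℂ :=
  if j.val % 2 = 0 then ((w ⟨j.val / 2, by have := j.isLt; omega⟩).re : ℂ)
  else ((w ⟨j.val / 2, by have := j.isLt; omega⟩).im : ℂ)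

/-- The partial derivative `∂/∂Z_j` in the `j`-th real coordinate of `ℂⁿ ≅ ℝ^{2n}`. -/
def realPDeriv {n : ℕ} (j : Fin (2 * n)) (f : (Fin n → ℂ) → ℂ) (z : Fin n → ℂ) : ℂ :=
  fderiv ℝ f z (coordDir j)

/-- The iterated partial derivative `∂^α` in the real coordinates of `ℂⁿ ≅ ℝ^{2n}`,
for a multi-index `α ∈ ℕ^{2n}`. -/
def iterD {n : ℕ} (α : Fin (2 * n) → ℕ) (f : (Fin n → ℂ) → ℂ) : (Fin n → ℂ) → ℂ :=
  (List.ofFn (fun j : Fin (2 * n) =>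
    (fun (g : (Fin n → ℂ) → ℂ) (z : Fin n → ℂ) => fderiv ℝ g z (coordDir j))^[α j])).foldr
    (· ∘ ·) id f

set_option linter.all false

abbrev PolyW := MvPolynomial (Fin 2) ℂ

def evW (p : PolyW) (w : ℂ) : ℂ := MvPolynomial.eval ![w, (starRingEnd ℂ) w] p

def gau (c : ℝ) (w : ℂ) : ℂ := Complex.exp (-((c : ℂ)) * (Complex.normSq w : ℂ))

def BP (p : PolyW) : PolyW :=
  MvPolynomial.C (2 * Real.pi : ℂ) * MvPolynomial.X 1 * p - MvPolynomial.C 2 * MvPolynomial.pderiv 0 p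

def dir (p : PolyW) (w : ℂ) : ℂ →L[ℝ] ℂ :=
  (evW (MvPolynomial.pderiv 0 p) w) • (ContinuousLinearMap.id ℝ ℂ) +
  (evW (MvPolynomial.pderiv 1 p) w) • (Complex.conjCLE : ℂ →L[ℝ] ℂ)

lemma evW_hasFDerivAt (p : PolyW) (w : ℂ) : HasFDerivAt (evW p) (dir p w) w := by
  induction p using MvPolynomial.induction_on with
  | C a =>
    have : dir (MvPolynomial.C a) w = 0 := by
      ext <;> simp [dir, evW]
    rw [this]
    have h2 : evW (MvPolynomial.C a) = fun _ => a := by ext; simp [evW]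
    rw [h2]; exact hasFDerivAt_const _ _
  | add p q hp hq =>
    have h2 : evW (p + q) = fun z => evW p z + evW q z := by ext; simp [evW]
    rw [h2]
    refine (hp.fun_add hq).congr_fderiv ?_
    ext <;> simp [dir, evW] <;> ring
  | mul_X p i hp =>
    have h2 : evW (p * MvPolynomial.X i) = fun z => evW p z * evW (MvPolynomial.X i) z := by
      ext; simp [evW]
    rw [h2]
    have hX : HasFDerivAt (evW (MvPolynomial.X i)) (dir (MvPolynomial.X i) w) w := by
      fin_cases i
      · have : evW (MvPolynomial.X 0) = fun z => z := by ext; simp [evW]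
        simp only [Fin.zero_eta, this]
        refine (hasFDerivAt_id (𝕜 := ℝ) w).congr_fderiv ?_
        ext <;> simp [dir, evW]
      · have : evW (MvPolynomial.X 1) = fun z => (Complex.conjCLE : ℂ →L[ℝ] ℂ) z := by
          ext; simp [evW]
        simp only [Fin.mk_one, this]
        refine ((Complex.conjCLE : ℂ →L[ℝ] ℂ).hasFDerivAt).congr_fderiv ?_
        ext <;> simp [dir, evW]
    refine (hp.fun_mul hX).congr_fderiv ?_
    ext <;> simp [dir, evW] <;> ring

def gdir (c : ℝ) (w : ℂ) : ℂ →L[ℝ] ℂ :=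
  (gau c w * (-(c : ℂ)) * (starRingEnd ℂ w)) • (ContinuousLinearMap.id ℝ ℂ) +
  (gau c w * (-(c : ℂ)) * w) • (Complex.conjCLE : ℂ →L[ℝ] ℂ)

lemma gau_hasFDerivAt (c : ℝ) (w : ℂ) : HasFDerivAt (gau c) (gdir c w) w := by
  have h1 : gau c = fun w => Complex.exp (-(c : ℂ) * (evW (MvPolynomial.X 0 * MvPolynomial.X 1) w)) := by
    ext w; simp [gau, evW, Complex.mul_conj]
  have h2 := ((evW_hasFDerivAt (MvPolynomial.X 0 * MvPolynomial.X 1) w).const_mul (-(c : ℂ))).cexp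
  rw [h1]
  refine h2.congr_fderiv ?_
  ext <;> simp [dir, gdir, evW, gau, Complex.mul_conj] <;> ring

lemma integrable_evW_gau (c : ℝ) (hc : 0 < c) (p : PolyW) :
    Integrable (fun w => evW p w * gau c w) := by
  induction p using MvPolynomial.induction_on' with
  | add p q hp hq =>
    have := hp.add hq
    refine this.congr (Filter.Eventually.of_forall fun w => ?_)
    simp [evW]; ring
  | monomial u a =>
    have hi : Integrable (fun w : ℂ => ‖w‖ ^ ((u 0 + u 1 : ℕ) : ℝ) * Real.exp (-c * ‖w‖ ^ (2:ℝ))) := by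
      apply Integrable.of_integral_ne_zero
      rw [Complex.integral_rpow_mul_exp_neg_mul_rpow (by norm_num) _ hc]
      · have : 0 < Real.Gamma ((((u 0 + u 1 : ℕ) : ℝ) + 2) / 2) := Real.Gamma_pos_of_pos (by positivity)
        positivity
      · have : (0:ℝ) ≤ ((u 0 + u 1 : ℕ) : ℝ) := by positivity
        linarith
    refine (hi.const_mul ‖a‖).mono' ?_ (Filter.Eventually.of_forall fun w => ?_)
    · have h1 : Continuous (fun w => evW (MvPolynomial.monomial u a) w * gau c w) := by
        refine continuous_iff_continuousAt.2 fun w => ?_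
        exact (evW_hasFDerivAt _ w).continuousAt.mul (gau_hasFDerivAt c w).continuousAt
      exact h1.aestronglyMeasurable
    · rw [norm_mul]
      have : ‖gau c w‖ = Real.exp (-c * ‖w‖ ^ (2:ℝ)) := by
        rw [show (2:ℝ) = ((2:ℕ):ℝ) by norm_num, Real.rpow_natCast, gau, Complex.norm_exp]
        simp [Complex.normSq_eq_norm_sq, ← Complex.ofReal_pow]
      rw [this, Real.rpow_natCast]
      simp [evW, MvPolynomial.eval_monomial, Finsupp.prod_fintype, pow_add, mul_assoc]

def LW (p : PolyW) : ℂ := ∫ w, evW p w * gau Real.pi w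

lemma LW_add (p q : PolyW) : LW (p + q) = LW p + LW q := by
  unfold LW
  rw [← integral_add (integrable_evW_gau _ Real.pi_pos p) (integrable_evW_gau _ Real.pi_pos q)]
  congr 1; ext w; simp [evW]; ring

lemma LW_C (c : ℂ) (p : PolyW) : LW (MvPolynomial.C c * p) = c * LW p := by
  unfold LW
  rw [← integral_const_mul]
  congr 1; ext w; simp [evW]; ring

lemma LW_ibp (p : PolyW) (v : ℂ) :
    v * LW (MvPolynomial.pderiv 0 p) + (starRingEnd ℂ v) * LW (MvPolynomial.pderiv 1 p)
     = Real.pi * (v * LW (MvPolynomial.X 1 * p) + (starRingEnd ℂ v) * LW (MvPolynomial.X 0 * p)) := by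
  have e1 : ∀ w, fderiv ℝ (evW p) w v * gau Real.pi w =
      evW (MvPolynomial.C v * MvPolynomial.pderiv 0 p +
        MvPolynomial.C (starRingEnd ℂ v) * MvPolynomial.pderiv 1 p) w * gau Real.pi w := by
    intro w
    rw [(evW_hasFDerivAt p w).fderiv]; simp [dir, evW]; left; ring
  have e2 : ∀ w, evW p w * fderiv ℝ (gau Real.pi) w v =
      evW (MvPolynomial.C (-(Real.pi : ℂ) * v) * (MvPolynomial.X 1 * p) +
        MvPolynomial.C (-(Real.pi : ℂ) * starRingEnd ℂ v) * (MvPolynomial.X 0 * p)) w * gau Real.pi w := by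
    intro w
    rw [(gau_hasFDerivAt _ w).fderiv]; simp [gdir, evW]; ring
  have := integral_mul_fderiv_eq_neg_fderiv_mul_of_integrable (μ := volume) (f := evW p)
    (g := gau Real.pi) (v := v)
    (by simp only [e1]; exact integrable_evW_gau _ Real.pi_pos _)
    (by simp only [e2]; exact integrable_evW_gau _ Real.pi_pos _)
    (integrable_evW_gau _ Real.pi_pos _)
    (fun w _ => (evW_hasFDerivAt p w).differentiableAt) (fun w _ => (gau_hasFDerivAt _ w).differentiableAt)
  simp only [e1, e2] at this
  change LW _ = - LW _ at this
  simp only [LW_add, LW_C] at this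
  linear_combination this

lemma LW_ibp0 (p : PolyW) : LW (MvPolynomial.pderiv 0 p) = Real.pi * LW (MvPolynomial.X 1 * p) := by
  have h1 := LW_ibp p 1
  have h2 := LW_ibp p Complex.I
  simp only [map_one, Complex.conj_I] at h1 h2
  linear_combination (1/2) * h1 - (Complex.I/2) * h2 +
    (1/2) * (LW (MvPolynomial.pderiv 0 p) - LW (MvPolynomial.pderiv 1 p) + Real.pi * (-LW (MvPolynomial.X 1 * p)
      + LW (MvPolynomial.X 0 * p)) ) * Complex.I_sq

lemma LW_ibp1 (p : PolyW) : LW (MvPolynomial.pderiv 1 p) = Real.pi * LW (MvPolynomial.X 0 * p) := by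
  have h1 := LW_ibp p 1
  have h0 := LW_ibp0 p
  simp only [map_one] at h1
  linear_combination h1 - h0

lemma LW_mono (b b' : ℕ) (h : b ≠ b') :
    LW ((MvPolynomial.X 0) ^ b * (MvPolynomial.X 1) ^ b') = 0 := by
  have hpi : (Real.pi : ℂ) ≠ 0 := by exact_mod_cast Real.pi_ne_zero
  induction b generalizing b' with
  | zero =>
    obtain ⟨k, rfl⟩ := Nat.exists_eq_succ_of_ne_zero h.symm
    have := LW_ibp0 (MvPolynomial.X 1 ^ k)
    have h0 : MvPolynomial.pderiv 0 ((MvPolynomial.X 1 : PolyW) ^ k) = 0 := by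
      simp [MvPolynomial.pderiv_pow]
    rw [h0] at this
    have hz : LW 0 = 0 := by simp [LW, evW]
    rw [hz] at this
    simp only [pow_zero, one_mul, Nat.succ_eq_add_one, pow_succ']
    exact (mul_eq_zero.1 this.symm).resolve_left hpi
  | succ b ih =>
    have := LW_ibp1 (MvPolynomial.X 0 ^ b * MvPolynomial.X 1 ^ b')
    have h0 : MvPolynomial.pderiv 1 ((MvPolynomial.X 0 : PolyW) ^ b * MvPolynomial.X 1 ^ b') =
       MvPolynomial.C (b' : ℂ) * (MvPolynomial.X 0 ^ b * MvPolynomial.X 1 ^ (b'-1)) := by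
      simp [MvPolynomial.pderiv_pow, MvPolynomial.pderiv_mul]; ring
    rw [h0, LW_C] at this
    have hz : (b' : ℂ) * LW (MvPolynomial.X 0 ^ b * MvPolynomial.X 1 ^ (b' - 1)) = 0 := by
      rcases b' with _ | k
      · simp
      · rw [Nat.add_sub_cancel, ih k (by omega)]; simp
    rw [hz] at this
    have h2 := (mul_eq_zero.1 this.symm).resolve_left hpi
    rw [← h2]; congr 1; ring

def BQ (p : PolyW) : PolyW :=
  MvPolynomial.C (2 * Real.pi : ℂ) * MvPolynomial.X 0 * p - MvPolynomial.C 2 * MvPolynomial.pderiv 1 p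

lemma pd_comm (p : PolyW) : MvPolynomial.pderiv 0 (MvPolynomial.pderiv 1 p) =
    MvPolynomial.pderiv 1 (MvPolynomial.pderiv 0 p) := by
  induction p using MvPolynomial.induction_on with
  | C a => simp
  | add p q hp hq => simp [hp, hq]
  | mul_X p i hp => fin_cases i <;> simp [hp, add_comm]

lemma pd_BQ (a b : ℕ) : MvPolynomial.pderiv 0 (BQ^[a] (MvPolynomial.X 1 ^ b)) =
    MvPolynomial.C (2 * Real.pi * a : ℂ) * BQ^[a-1] (MvPolynomial.X 1 ^ b) := by
  induction a with
  | zero => simp [MvPolynomial.pderiv_pow]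
  | succ a ih =>
    rw [Function.iterate_succ_apply']
    set q := BQ^[a] (MvPolynomial.X 1 ^ b) with hq
    have h1 : MvPolynomial.pderiv 0 (BQ q) = MvPolynomial.C (2 * Real.pi : ℂ) * q + BQ (MvPolynomial.pderiv 0 q) := by
      simp [BQ, MvPolynomial.pderiv_mul, pd_comm]; ring
    have h2 : BQ (MvPolynomial.pderiv 0 q) = MvPolynomial.C (2 * Real.pi * a : ℂ) * q := by
      rw [ih]
      have hc : ∀ (c : ℂ) p, BQ (MvPolynomial.C c * p) = MvPolynomial.C c * BQ p := by
        intro c p; simp [BQ, MvPolynomial.pderiv_mul]; ring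
      rw [hc, hq]
      rcases a with _ | k
      · simp
      · rw [Nat.add_sub_cancel, Function.iterate_succ_apply']
    rw [h1, h2, Nat.add_sub_cancel, ← hq]
    push_cast
    simp only [map_mul, map_add, map_one]; ring

lemma LW_BP (p q : PolyW) : LW (BP p * q) = 2 * LW (p * MvPolynomial.pderiv 0 q) := by
  have h : BP p * q = MvPolynomial.C (2 * Real.pi : ℂ) * (MvPolynomial.X 1 * (p * q)) +
     (MvPolynomial.C (-2) * MvPolynomial.pderiv 0 (p * q) + MvPolynomial.C 2 * (p * MvPolynomial.pderiv 0 q)) := by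
    simp [BP, MvPolynomial.pderiv_mul]; ring
  rw [h]; simp only [LW_add, LW_C]; rw [LW_ibp0]; ring

lemma LW_orth (a b a' b' : ℕ) (hle : a' ≤ a) (h : (a, b) ≠ (a', b')) :
    LW (BP^[a] (MvPolynomial.X 0 ^ b) * BQ^[a'] (MvPolynomial.X 1 ^ b')) = 0 := by
  induction a generalizing a' with
  | zero =>
    obtain rfl : a' = 0 := by omega
    exact LW_mono _ _ (by rintro rfl; exact h rfl)
  | succ a ih =>
    rw [Function.iterate_succ_apply', LW_BP, pd_BQ]
    rw [mul_left_comm, LW_C]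
    rcases a' with _ | k
    · simp
    · rw [Nat.add_sub_cancel, ih k (by omega) (by simpa using h)]; simp

lemma conj_evW (a b : ℕ) (w : ℂ) : (starRingEnd ℂ) (evW (BP^[a] (MvPolynomial.X 0 ^ b)) w) =
    evW (BQ^[a] (MvPolynomial.X 1 ^ b)) w := by
  let σ : PolyW → PolyW := fun p =>
    MvPolynomial.rename (Equiv.swap (0 : Fin 2) 1) (MvPolynomial.map (starRingEnd ℂ) p)
  have hs : ∀ p w, (starRingEnd ℂ) (evW p w) = evW (σ p) w := by
    intro p w
    induction p using MvPolynomial.induction_on with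
    | C a => simp [evW, σ]
    | add p q hp hq => simp only [evW, σ, map_add] at *; rw [hp, hq]
    | mul_X p i hp =>
      simp only [evW, σ, map_mul] at *; rw [hp]; fin_cases i <;> simp
  have hd : ∀ p, σ (MvPolynomial.pderiv 0 p) = MvPolynomial.pderiv 1 (σ p) := by
    intro p
    induction p using MvPolynomial.induction_on with
    | C a => simp [σ]
    | add p q hp hq => simp only [σ, map_add] at *; rw [hp, hq]
    | mul_X p i hp =>
      simp only [σ, map_mul, MvPolynomial.pderiv_mul, map_add] at *; rw [hp]; fin_cases i <;> simp
  have hB : ∀ p, σ (BP p) = BQ (σ p) := by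
    intro p
    simp only [BQ, ← hd, BP]
    have h2 : (starRingEnd ℂ) (2 : ℂ) = 2 := map_ofNat _ 2
    simp [σ, h2]
  rw [hs]; congr 1
  induction a with
  | zero => simp [σ]
  | succ a ih => rw [Function.iterate_succ_apply', Function.iterate_succ_apply', hB, ih]

def G1 (p : PolyW) (w : ℂ) : ℂ := evW p w * gau (Real.pi / 2) w

lemma orth1 (a b a' b' : ℕ) (h : (a, b) ≠ (a', b')) :
    ∫ w, G1 (BP^[a] (MvPolynomial.X 0 ^ b)) w * (starRingEnd ℂ) (G1 (BP^[a'] (MvPolynomial.X 0 ^ b')) w) = 0 := by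
  have key : ∀ a b a' b' : ℕ, a' ≤ a → (a, b) ≠ (a', b') →
    ∫ w, G1 (BP^[a] (MvPolynomial.X 0 ^ b)) w * (starRingEnd ℂ) (G1 (BP^[a'] (MvPolynomial.X 0 ^ b')) w) = 0 := by
    intro a b a' b' hle h
    rw [← LW_orth a b a' b' hle h, LW]
    congr 1; ext w
    have hg : gau (Real.pi/2) w * (starRingEnd ℂ) (gau (Real.pi/2) w) = gau Real.pi w := by
      simp only [gau, ← Complex.exp_conj, ← Complex.exp_add]
      have h2 : (starRingEnd ℂ) (2 : ℂ) = 2 := map_ofNat _ 2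
      congr 1; simp [h2]; ring
    have hm : ∀ p q, evW (p * q) w = evW p w * evW q w := by intro p q; simp [evW]
    rw [hm, ← hg, ← conj_evW]; simp only [G1, map_mul]; ring
  rcases le_total a' a with hl | hl
  · exact key a b a' b' hl h
  · have := key a' b' a b hl h.symm
    have h2 := congrArg (starRingEnd ℂ) this
    rw [← integral_conj] at h2
    simpa [mul_comm] using h2

def FW {n : ℕ} (p : Fin n → PolyW) (z : Fin n → ℂ) : ℂ := ∏ i, G1 (p i) (z i)

lemma G1_hasFDerivAt (p : PolyW) (w : ℂ) :
    HasFDerivAt (G1 p) (evW p w • gdir (Real.pi / 2) w + gau (Real.pi / 2) w • dir p w) w :=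
  (evW_hasFDerivAt p w).fun_mul (gau_hasFDerivAt _ w)

lemma fderiv_FW {n : ℕ} (p : Fin n → PolyW) (z : Fin n → ℂ) (j : Fin n) (v : ℂ) :
    fderiv ℝ (FW p) z (Pi.single j v) =
      (∏ i ∈ Finset.univ.erase j, G1 (p i) (z i)) * 
        (evW (p j) (z j) • gdir (Real.pi / 2) (z j) + gau (Real.pi / 2) (z j) • dir (p j) (z j)) v := by
  have h : ∀ i ∈ (Finset.univ : Finset (Fin n)), HasFDerivAt (fun z : Fin n → ℂ => G1 (p i) (z i))
      ((evW (p i) (z i) • gdir (Real.pi / 2) (z i) + gau (Real.pi / 2) (z i) • dir (p i) (z i)).comp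
        (ContinuousLinearMap.proj (R := ℝ) (φ := fun _ : Fin n => ℂ) i)) z := by
    intro i _
    exact (G1_hasFDerivAt (p i) (z i)).comp z
      (ContinuousLinearMap.proj (R := ℝ) (φ := fun _ : Fin n => ℂ) i).hasFDerivAt
  have h2 := HasFDerivAt.finsetProd h
  have h3 : fderiv ℝ (FW p) z = _ := h2.fderiv
  rw [h3, ContinuousLinearMap.sum_apply, Finset.sum_eq_single j]
  · simp only [ContinuousLinearMap.smul_apply, ContinuousLinearMap.comp_apply,
      ContinuousLinearMap.proj_apply, Pi.single_eq_same, smul_eq_mul]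
  · intro i _ hij
    simp only [ContinuousLinearMap.smul_apply, ContinuousLinearMap.comp_apply,
      ContinuousLinearMap.proj_apply, Pi.single_eq_of_ne hij, map_zero, smul_zero]
  · simp

lemma bOp_FW {n : ℕ} (p : Fin n → PolyW) (j : Fin n) :
    bOp j (FW p) = FW (Function.update p j (BP (p j))) := by
  ext z
  have e1 : FW p z = (∏ i ∈ Finset.univ.erase j, G1 (p i) (z i)) * G1 (p j) (z j) := by
    rw [FW, Finset.prod_erase_mul _ _ (Finset.mem_univ j)]
  have e2 : FW (Function.update p j (BP (p j))) z =
      (∏ i ∈ Finset.univ.erase j, G1 (p i) (z i)) * G1 (BP (p j)) (z j) := by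
    rw [FW, ← Finset.prod_erase_mul _ _ (Finset.mem_univ j)]
    congr 1
    · refine Finset.prod_congr rfl fun i hi => ?_
      rw [Function.update_of_ne (Finset.ne_of_mem_erase hi)]
    · rw [Function.update_self]
  rw [e2]
  simp only [bOp, wirtingerD, fderiv_FW, e1]
  have e3 : evW (BP (p j)) (z j) = 2 * Real.pi * (starRingEnd ℂ) (z j) * evW (p j) (z j)
      - 2 * evW (MvPolynomial.pderiv 0 (p j)) (z j) := by
    simp [evW, BP]
  simp only [G1, e3]
  simp only [dir, gdir, ContinuousLinearMap.add_apply, ContinuousLinearMap.smul_apply,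
    ContinuousLinearMap.id_apply, smul_eq_mul, ContinuousLinearEquiv.coe_coe,
    Complex.conjCLE_apply, map_one, Complex.conj_I]
  push_cast
  generalize (∏ i ∈ Finset.univ.erase j, evW (p i) (z i) * gau (Real.pi / 2) (z i)) = A
  generalize evW (p j) (z j) = E
  generalize evW (MvPolynomial.pderiv 0 (p j)) (z j) = E0
  generalize evW (MvPolynomial.pderiv 1 (p j)) (z j) = E1
  generalize gau (Real.pi / 2) (z j) = g
  generalize (starRingEnd ℂ) (z j) = zb
  have := Complex.I_sq
  ring_nf
  simp only [Complex.I_sq]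
  ring

lemma bOp_iter_FW {n : ℕ} (p : Fin n → PolyW) (j : Fin n) (k : ℕ) :
    (bOp j)^[k] (FW p) = FW (Function.update p j (BP^[k] (p j))) := by
  induction k with
  | zero => simp
  | succ k ih =>
    rw [Function.iterate_succ_apply', ih, bOp_FW, Function.iterate_succ_apply']
    simp

lemma foldr_FW {n : ℕ} (α : Fin n → ℕ) (p : Fin n → PolyW) (l : List (Fin n)) (hl : l.Nodup) :
    (l.map (fun j => (bOp j)^[α j])).foldr (· ∘ ·) id (FW p) =
      FW (fun i => if i ∈ l then BP^[α i] (p i) else p i) := by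
  induction l with
  | nil => simp
  | cons j l ih =>
    rw [List.nodup_cons] at hl
    simp only [List.map_cons, List.foldr_cons, Function.comp_apply]
    rw [ih hl.2, bOp_iter_FW]
    congr 1; ext1 i
    by_cases hij : i = j
    · subst hij; simp [hl.1]
    · simp [hij]

lemma eigFun_eq {n : ℕ} (α β : Fin n → ℕ) :
    eigFun α β = FW (fun i => BP^[α i] (MvPolynomial.X 0 ^ β i)) := by
  have h0 : (fun z : Fin n → ℂ => (∏ j, z j ^ β j) * gaussFn z) =
      FW (fun i => MvPolynomial.X 0 ^ β i) := by
    ext z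
    simp only [FW, G1, Finset.prod_mul_distrib, gau, gaussFn, ← Complex.exp_sum, evW]
    congr 1
    · simp
    · rw [Finset.mul_sum]; push_cast; rfl
  rw [eigFun, h0, bPow, List.ofFn_eq_map, foldr_FW _ _ _ (List.nodup_finRange n)]
  simp

/-- For `(α, β) ≠ (α', β')` the functions `f_{α,β}` and `f_{α',β'}` are
orthogonal in `L²(ℂⁿ; ℂ)`. -/
theorem eigFun_orthogonal {n : ℕ} (α β α' β' : Fin n → ℕ) (h : (α, β) ≠ (α', β')) :
    ∫ Z : Fin n → ℂ, eigFun α β Z * (starRingEnd ℂ) (eigFun α' β' Z) = 0 := by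
  have h1 : ∃ i, (α i, β i) ≠ (α' i, β' i) := by
    by_contra hc
    push Not at hc
    apply h
    ext i
    · exact (Prod.ext_iff.1 (hc i)).1
    · exact (Prod.ext_iff.1 (hc i)).2
  obtain ⟨i, hi⟩ := h1
  simp only [eigFun_eq, FW, map_prod, ← Finset.prod_mul_distrib]
  rw [integral_fintype_prod_volume_eq_prod (fun i w => G1 (BP^[α i] (MvPolynomial.X 0 ^ β i)) w *
    (starRingEnd ℂ) (G1 (BP^[α' i] (MvPolynomial.X 0 ^ β' i)) w))]
  exact Finset.prod_eq_zero (Finset.mem_univ i) (orth1 _ _ _ _ hi)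
end
end

section
/- The linear span of the family of functions {f_{α,β} = b^α (z^β exp(−(π/2) Σ_{i=1}^n |z_i|²)) : α, β ∈ ℕ^n} is dense in L²(ℂ^n; ℂ) (with respect to Lebesgue measure on ℂ^n ≅ ℝ^{2n}). -/
open MeasureTheory Complex

noncomputable section

namespace EigDense

open MvPolynomial

/-- Polynomials in `z` (`inl`) and `z̄` (`inr`). -/
abbrev Poly (n : ℕ) := MvPolynomial (Fin n ⊕ Fin n) ℂ

/-- The evaluation point `(z, z̄)`. -/
def pt {n : ℕ} (z : Fin n → ℂ) : Fin n ⊕ Fin n → ℂ :=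
  Sum.elim z (fun i => (starRingEnd ℂ) (z i))

/-- `P(z, z̄)` times the Gaussian. -/
def Phi {n : ℕ} (P : Poly n) (z : Fin n → ℂ) : ℂ := eval (pt z) P * gaussFn z

/-- The operator `b_j` on polynomials. -/
def B {n : ℕ} (j : Fin n) : Module.End ℂ (Poly n) :=
  (-2 : ℂ) • (pderiv (R := ℂ) (Sum.inl j : Fin n ⊕ Fin n)).toLinearMap +
    (2 * (Real.pi : ℂ)) • LinearMap.mulLeft ℂ (X (Sum.inr j))

lemma B_apply {n : ℕ} (j : Fin n) (P : Poly n) :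
    B j P = (-2 : ℂ) • pderiv (Sum.inl j) P + (2 * (Real.pi : ℂ)) • (X (Sum.inr j) * P) := rfl

lemma pderiv_comm {σ : Type*} (i j : σ) (P : MvPolynomial σ ℂ) :
    pderiv i (pderiv j P) = pderiv j (pderiv i P) := by
  classical
  have h : ⁅pderiv (R := ℂ) i, pderiv (R := ℂ) j⁆ = 0 := by
    apply MvPolynomial.derivation_ext
    intro k
    rw [Derivation.commutator_apply]
    simp only [pderiv_X, Pi.single_apply]
    split_ifs <;> simp
  have := congrArg (fun D => D P) h
  simpa [Derivation.commutator_apply, sub_eq_zero] using this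

lemma B_comm {n : ℕ} (i j : Fin n) : Commute (B i) (B j) := by
  refine LinearMap.ext fun P => ?_
  have h1 : ∀ i j : Fin n, pderiv (Sum.inl i) (X (Sum.inr j) : Poly n) = 0 := fun i j =>
    pderiv_X_of_ne (by simp)
  simp only [Module.End.mul_apply, B_apply, smul_eq_C_mul, map_add, Derivation.leibniz, h1,
    pderiv_C, smul_eq_mul]
  rw [pderiv_comm (Sum.inl i) (Sum.inl j)]
  ring

lemma B_mul_prod {n : ℕ} (j : Fin n) (α : Fin n → ℕ) (l : List (Fin n)) (hl : l.Nodup)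
    (hj : j ∈ l) :
    B j * (l.map fun i => B i ^ α i).prod =
      (l.map fun i => B i ^ (Function.update α j (α j + 1)) i).prod := by
  induction l with
  | nil => simp at hj
  | cons a l ih =>
    simp only [List.map_cons, List.prod_cons]
    rw [List.nodup_cons] at hl
    by_cases h : a = j
    · subst h
      rw [← mul_assoc, ← pow_succ']
      simp only [Function.update_self]
      congr 2
      apply List.map_congr_left
      intro i hi
      have : i ≠ a := fun h => hl.1 (h ▸ hi)
      simp [this]
    · have hj' : j ∈ l := by
        rcases List.mem_cons.1 hj with h' | h'
        · exact absurd h'.symm h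
        · exact h'
      rw [← mul_assoc, ((B_comm j a).pow_right (α a)).eq, mul_assoc, ih hl.2 hj']
      simp [h]

/-- Iterated operator on polynomials. -/
def BPow {n : ℕ} (α : Fin n → ℕ) : Module.End ℂ (Poly n) :=
  (List.ofFn fun j => B j ^ α j).prod

/-- Span of the polynomials of the eigenfunctions. -/
def V (n : ℕ) : Submodule ℂ (Poly n) :=
  Submodule.span ℂ (Set.range fun p : (Fin n → ℕ) × (Fin n → ℕ) =>
    BPow p.1 (∏ j, X (Sum.inl j) ^ p.2 j))

lemma B_mem_V {n : ℕ} (j : Fin n) {P : Poly n} (hP : P ∈ V n) : B j P ∈ V n := by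
  have : V n ≤ (V n).comap (B j) := by
    rw [V, Submodule.span_le]
    rintro _ ⟨⟨α, β⟩, rfl⟩
    refine Submodule.subset_span ⟨(Function.update α j (α j + 1), β), ?_⟩
    simp only [BPow, List.ofFn_eq_map]
    rw [← B_mul_prod j α _ (List.nodup_finRange n) (List.mem_finRange j)]
    rfl
  exact this hP

lemma monomial_mem_V {n : ℕ} (m : ℕ) : ∀ f : (Fin n ⊕ Fin n) →₀ ℕ,
    (∑ j, f (Sum.inr j)) = m → (monomial f (1 : ℂ)) ∈ V n := by
  induction m with
  | zero =>
    intro f hf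
    refine Submodule.subset_span ⟨(0, fun j => f (Sum.inl j)), ?_⟩
    have h0 : ∀ j, f (Sum.inr j) = 0 := by simpa using hf
    have : (BPow (0 : Fin n → ℕ)) = 1 := by
      simp [BPow]
    simp only [this, Module.End.one_apply]
    rw [monomial_eq, Finsupp.prod_fintype _ _ (by simp)]
    simp [h0]
  | succ m ih =>
    intro f hf
    obtain ⟨j, hj⟩ : ∃ j, f (Sum.inr j) ≠ 0 := by
      by_contra! h
      simp [h] at hf
    obtain ⟨g, rfl⟩ : ∃ g, f = g + Finsupp.single (Sum.inr j) 1 := by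
      refine ⟨f - Finsupp.single (Sum.inr j) 1, ?_⟩
      rw [tsub_add_cancel_of_le]
      simpa using Nat.one_le_iff_ne_zero.2 hj
    have hg : ∑ i, g (Sum.inr i) = m := by
      simp [Finset.sum_add_distrib, Finsupp.single_apply] at hf
      exact hf
    have h1 := B_mem_V j (ih g hg)
    have h2 : monomial (g - Finsupp.single (Sum.inl j) 1) (1 : ℂ) ∈ V n := by
      apply ih
      simpa [Finsupp.single_apply] using hg
    have h3 : (monomial (g + Finsupp.single (Sum.inr j) 1) (1 : ℂ) : Poly n) =
        (2 * (Real.pi : ℂ))⁻¹ • (B j (monomial g 1) +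
          (2 * (g (Sum.inl j) : ℂ)) • monomial (g - Finsupp.single (Sum.inl j) 1) (1 : ℂ)) := by
      have hpi : (2 * (Real.pi : ℂ)) ≠ 0 := by simp [Real.pi_ne_zero]
      rw [eq_inv_smul_iff₀ hpi, B_apply, pderiv_monomial, mul_comm (X _), X, monomial_mul]
      simp only [smul_monomial, smul_eq_mul, one_mul, mul_one]
      rw [add_right_comm, ← map_add]
      simp
    rw [h3]
    exact (V n).smul_mem _ ((V n).add_mem h1 ((V n).smul_mem _ h2))

lemma V_eq_top (n : ℕ) : V n = ⊤ := by
  rw [eq_top_iff]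
  intro P _
  rw [P.as_sum]
  refine Submodule.sum_mem _ fun f _ => ?_
  have : monomial f (P.coeff f) = P.coeff f • monomial f (1 : ℂ) := by
    simp [smul_monomial]
  rw [this]
  exact (V n).smul_mem _ (monomial_mem_V _ f rfl)

lemma wirtingerD_add {n : ℕ} (j : Fin n) {f g : (Fin n → ℂ) → ℂ} {z : Fin n → ℂ}
    (hf : DifferentiableAt ℝ f z) (hg : DifferentiableAt ℝ g z) :
    wirtingerD j (fun z => f z + g z) z = wirtingerD j f z + wirtingerD j g z := by
  simp only [wirtingerD]
  rw [fderiv_fun_add hf hg]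
  simp only [add_apply]
  ring

lemma wirtingerD_mul {n : ℕ} (j : Fin n) {f g : (Fin n → ℂ) → ℂ} {z : Fin n → ℂ}
    (hf : DifferentiableAt ℝ f z) (hg : DifferentiableAt ℝ g z) :
    wirtingerD j (fun z => f z * g z) z = wirtingerD j f z * g z + f z * wirtingerD j g z := by
  simp only [wirtingerD]
  rw [fderiv_fun_mul hf hg]
  simp only [add_apply, smul_apply, smul_eq_mul]
  ring

lemma wirtingerD_exp {n : ℕ} (j : Fin n) {f : (Fin n → ℂ) → ℂ} {z : Fin n → ℂ}
    (hf : DifferentiableAt ℝ f z) :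
    wirtingerD j (fun z => Complex.exp (f z)) z = Complex.exp (f z) * wirtingerD j f z := by
  simp only [wirtingerD]
  rw [(hf.hasFDerivAt.cexp).fderiv]
  simp only [smul_apply, smul_eq_mul]
  ring

lemma pt_hasFDerivAt {n : ℕ} (i : Fin n ⊕ Fin n) (z : Fin n → ℂ) :
    HasFDerivAt (𝕜 := ℝ) (fun z : Fin n → ℂ => pt z i)
      (match i with
        | Sum.inl k => ContinuousLinearMap.proj (R := ℝ) (φ := fun _ : Fin n => ℂ) k
        | Sum.inr k => (Complex.conjCLE : ℂ →L[ℝ] ℂ) ∘L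
            ContinuousLinearMap.proj (R := ℝ) (φ := fun _ : Fin n => ℂ) k) z := by
  rcases i with k | k
  · exact ContinuousLinearMap.hasFDerivAt
      (ContinuousLinearMap.proj (R := ℝ) (φ := fun _ : Fin n => ℂ) k)
  · exact ContinuousLinearMap.hasFDerivAt ((Complex.conjCLE : ℂ →L[ℝ] ℂ) ∘L
            ContinuousLinearMap.proj (R := ℝ) (φ := fun _ : Fin n => ℂ) k)

lemma wirtingerD_pt {n : ℕ} (j : Fin n) (i : Fin n ⊕ Fin n) (z : Fin n → ℂ) :
    wirtingerD j (fun z => pt z i) z = eval (pt z) (pderiv (Sum.inl j) (X i)) := by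
  classical
  simp only [wirtingerD]
  rw [(pt_hasFDerivAt i z).fderiv]
  rcases i with k | k
  · by_cases h : k = j
    · subst h
      simp
      norm_num
    · rw [pderiv_X_of_ne (by simpa using h)]
      simp [h]
  · rw [pderiv_X_of_ne (by simp)]
    by_cases h : k = j
    · subst h
      simp
    · simp [h]

lemma poly_diff {n : ℕ} (P : Poly n) : Differentiable ℝ (fun z : Fin n → ℂ => eval (pt z) P) := by
  induction P using MvPolynomial.induction_on with
  | C a => simp
  | add p q hp hq =>
    simp only [map_add]
    exact hp.add hq
  | mul_X p i hp =>
    simp only [map_mul, eval_X]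
    exact hp.mul fun z => (pt_hasFDerivAt i z).differentiableAt

lemma wirtingerD_poly {n : ℕ} (j : Fin n) (P : Poly n) (z : Fin n → ℂ) :
    wirtingerD j (fun z => eval (pt z) P) z = eval (pt z) (pderiv (Sum.inl j) P) := by
  induction P using MvPolynomial.induction_on with
  | C a => simp [wirtingerD]
  | add p q hp hq =>
    simp only [map_add]
    rw [wirtingerD_add j (poly_diff p z) (poly_diff q z), hp, hq]
  | mul_X p i hp =>
    simp only [map_mul, eval_X]
    rw [wirtingerD_mul j (poly_diff p z) (pt_hasFDerivAt i z).differentiableAt, hp,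
      wirtingerD_pt, Derivation.leibniz]
    simp only [smul_eq_mul, map_add, map_mul, eval_X]
    ring

/-- The exponent of the Gaussian as a polynomial. -/
def Q (n : ℕ) : Poly n := C (-((Real.pi : ℂ) / 2)) * ∑ i, X (Sum.inl i) * X (Sum.inr i)

lemma gauss_eq {n : ℕ} : (gaussFn : (Fin n → ℂ) → ℂ) = fun z => Complex.exp (eval (pt z) (Q n)) := by
  funext z
  simp [gaussFn, Q, pt, Complex.mul_conj]

lemma gauss_diff {n : ℕ} : Differentiable ℝ (gaussFn : (Fin n → ℂ) → ℂ) := by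
  rw [gauss_eq]
  exact (poly_diff _).cexp

lemma pderiv_Q {n : ℕ} (j : Fin n) :
    pderiv (Sum.inl j) (Q n) = C (-((Real.pi : ℂ) / 2)) * X (Sum.inr j) := by
  classical
  rw [Q, pderiv_C_mul, map_sum]
  congr 1
  rw [Finset.sum_eq_single j]
  · simp [Derivation.leibniz, pderiv_X_of_ne]
  · intro i _ hi
    simp [Derivation.leibniz, pderiv_X_of_ne, hi]
  · simp

lemma bOp_Phi {n : ℕ} (j : Fin n) (P : Poly n) : bOp j (Phi P) = Phi (B j P) := by
  funext z
  have h1 : wirtingerD j gaussFn z = gaussFn z * (-((Real.pi : ℂ) / 2) * (starRingEnd ℂ) (z j)) := by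
    rw [gauss_eq, wirtingerD_exp j (poly_diff _ z), wirtingerD_poly, pderiv_Q]
    simp [pt]
  have h2 : wirtingerD j (Phi P) z = eval (pt z) (pderiv (Sum.inl j) P) * gaussFn z +
      eval (pt z) P * wirtingerD j gaussFn z := by
    unfold Phi
    rw [wirtingerD_mul j (poly_diff P z) (gauss_diff z), wirtingerD_poly]
  simp only [bOp, h2, h1, Phi, B_apply]
  simp only [map_add, smul_eval, map_mul, eval_X]
  simp only [pt, Sum.elim_inr]
  ring

lemma bOp_iter {n : ℕ} (j : Fin n) (k : ℕ) (P : Poly n) :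
    (bOp j)^[k] (Phi P) = Phi ((B j ^ k) P) := by
  induction k with
  | zero => simp
  | succ k ih => rw [Function.iterate_succ_apply', ih, bOp_Phi, pow_succ']; rfl

lemma bPow_Phi {n : ℕ} (α : Fin n → ℕ) (P : Poly n) : bPow α (Phi P) = Phi (BPow α P) := by
  simp only [bPow, BPow, List.ofFn_eq_map]
  induction List.finRange n with
  | nil => simp
  | cons a l ih =>
    simp only [List.map_cons, List.foldr_cons, List.prod_cons, Function.comp_apply,
      Module.End.mul_apply]
    rw [ih, bOp_iter]

lemma Phi_mem {n : ℕ} (P : Poly n) :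
    Phi P ∈ Submodule.span ℂ {f : (Fin n → ℂ) → ℂ | ∃ α β : Fin n → ℕ, f = eigFun α β} := by
  have hP : P ∈ V n := by rw [V_eq_top]; trivial
  refine Submodule.span_induction (p := fun P _ => Phi P ∈ _) ?_ ?_ ?_ ?_ hP
  · rintro _ ⟨⟨α, β⟩, rfl⟩
    refine Submodule.subset_span ⟨α, β, ?_⟩
    rw [← bPow_Phi, eigFun]
    congr 1
    funext z
    simp [Phi, pt]
  · have : Phi (0 : Poly n) = 0 := by funext z; simp [Phi]
    rw [this]
    exact Submodule.zero_mem _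
  · intro p q _ _ hp hq
    have : Phi (p + q) = Phi p + Phi q := by funext z; simp [Phi, add_mul]
    rw [this]
    exact Submodule.add_mem _ hp hq
  · intro c p _ hp
    have : Phi (c • p) = c • Phi p := by funext z; simp [Phi, mul_assoc]
    rw [this]
    exact Submodule.smul_mem _ _ hp

/-- An integrable real function with vanishing Fourier transform vanishes a.e. -/
lemma real_zero {E : Type*} [NormedAddCommGroup E] [NormedSpace ℝ E] [MeasurableSpace E]
    [BorelSpace E] [SecondCountableTopology E] [CompleteSpace E] {μ : Measure E} {u : E → ℝ}
    (hu : Integrable u μ)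
    (h : ∀ L : StrongDual ℝ E, ∫ x, (u x : ℂ) * Complex.exp ((L x : ℂ) * Complex.I) ∂μ = 0) :
    u =ᵐ[μ] 0 := by
  have hf1 := isFiniteMeasure_withDensity_ofReal hu.2
  have hf2 := isFiniteMeasure_withDensity_ofReal hu.neg.2
  have m1 : AEMeasurable (fun x => ENNReal.ofReal (u x)) μ := hu.1.aemeasurable.ennreal_ofReal
  have m2 : AEMeasurable (fun x => ENNReal.ofReal ((-u) x)) μ :=
    hu.neg.1.aemeasurable.ennreal_ofReal
  have hb : ∀ (L : StrongDual ℝ E) (w : E → ℝ), Integrable w μ →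
      Integrable (fun x => (ENNReal.ofReal (w x)).toReal • Complex.exp ((L x : ℂ) * Complex.I)) μ := by
    intro L w hw
    have hw' : Integrable (fun x => (ENNReal.ofReal (w x)).toReal) μ := by
      simpa only [ENNReal.toReal_ofReal'] using hw.pos_part
    refine (hw'.norm).mono' ?_ ?_
    · refine hw'.1.smul (Continuous.aestronglyMeasurable ?_)
      fun_prop
    · refine Filter.Eventually.of_forall fun x => ?_
      rw [norm_smul, Complex.norm_exp_ofReal_mul_I, mul_one]
  have key : μ.withDensity (fun x => ENNReal.ofReal (u x)) =
      μ.withDensity (fun x => ENNReal.ofReal ((-u) x)) := by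
    apply Measure.ext_of_charFunDual
    funext L
    rw [charFunDual_apply, charFunDual_apply,
      integral_withDensity_eq_integral_toReal_smul₀ m1 (by simp),
      integral_withDensity_eq_integral_toReal_smul₀ m2 (by simp), ← sub_eq_zero,
      ← integral_sub (hb L u hu) (hb L (-u) hu.neg), ← h L]
    refine integral_congr_ae (Filter.Eventually.of_forall fun x => ?_)
    simp only [ENNReal.toReal_ofReal', Pi.neg_apply]
    rw [← sub_smul, max_zero_sub_max_neg_zero_eq_self, Complex.real_smul]
  rw [withDensity_eq_iff m1 m2 hu.lintegral_lt_top.ne] at key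
  filter_upwards [key] with x hx
  have := congrArg ENNReal.toReal hx
  simp only [ENNReal.toReal_ofReal', Pi.neg_apply] at this
  have h2 := max_zero_sub_max_neg_zero_eq_self (u x)
  simp only [Pi.zero_apply]
  linarith

lemma complex_zero {E : Type*} [NormedAddCommGroup E] [NormedSpace ℝ E] [MeasurableSpace E]
    [BorelSpace E] [SecondCountableTopology E] [CompleteSpace E] {μ : Measure E} {u : E → ℂ}
    (hu : Integrable u μ)
    (h : ∀ L : StrongDual ℝ E, ∫ x, u x * Complex.exp ((L x : ℂ) * Complex.I) ∂μ = 0) :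
    u =ᵐ[μ] 0 := by
  have hi : ∀ (w : E → ℂ) (L : StrongDual ℝ E), Integrable w μ →
      Integrable (fun x => w x * Complex.exp ((L x : ℂ) * Complex.I)) μ := by
    intro w L hw
    refine hw.norm.mono' (hw.1.mul (Continuous.aestronglyMeasurable (by fun_prop))) ?_
    refine Filter.Eventually.of_forall fun x => ?_
    rw [norm_mul, Complex.norm_exp_ofReal_mul_I, mul_one]
  have hc : Integrable (fun x => (starRingEnd ℂ) (u x)) μ :=
    (Complex.conjCLE : ℂ →L[ℝ] ℂ).integrable_comp hu
  have h' : ∀ L : StrongDual ℝ E,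
      ∫ x, (starRingEnd ℂ) (u x) * Complex.exp ((L x : ℂ) * Complex.I) ∂μ = 0 := by
    intro L
    have := congrArg (starRingEnd ℂ) (h (-L))
    rw [← integral_conj, map_zero] at this
    rw [← this]
    refine integral_congr_ae (Filter.Eventually.of_forall fun x => ?_)
    simp [← Complex.exp_conj]
  have hre : (fun x => (u x).re) =ᵐ[μ] 0 := by
    have hr : Integrable (fun x => (u x).re) μ := hu.re
    apply real_zero hr
    intro L
    have : ∀ x, ((u x).re : ℂ) * Complex.exp ((L x : ℂ) * Complex.I) =
        (1 / 2) * (u x * Complex.exp ((L x : ℂ) * Complex.I) +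
          (starRingEnd ℂ) (u x) * Complex.exp ((L x : ℂ) * Complex.I)) := by
      intro x
      rw [Complex.re_eq_add_conj]
      ring
    simp only [this]
    rw [integral_const_mul, integral_add (hi _ L hu) (hi _ L hc), h L, h' L]
    simp
  have him : (fun x => (u x).im) =ᵐ[μ] 0 := by
    have hr : Integrable (fun x => (u x).im) μ := hu.im
    apply real_zero hr
    intro L
    have : ∀ x, ((u x).im : ℂ) * Complex.exp ((L x : ℂ) * Complex.I) =
        (1 / (2 * Complex.I)) * (u x * Complex.exp ((L x : ℂ) * Complex.I) -
          (starRingEnd ℂ) (u x) * Complex.exp ((L x : ℂ) * Complex.I)) := by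
      intro x
      rw [Complex.im_eq_sub_conj]
      ring
    simp only [this]
    rw [integral_const_mul, integral_sub (hi _ L hu) (hi _ L hc), h L, h' L]
    simp
  filter_upwards [hre, him] with x h1 h2
  exact Complex.ext h1 h2

/-- The linear weight. -/
def sumNorm {n : ℕ} (z : Fin n → ℂ) : ℝ := ∑ i, ‖z i‖

lemma norm_gauss {n : ℕ} (z : Fin n → ℂ) :
    ‖gaussFn z‖ = ∏ i, Real.exp (-(Real.pi / 2) * ‖z i‖ ^ 2) := by
  rw [← Real.exp_sum, ← Finset.mul_sum, gaussFn, Complex.norm_exp]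
  congr 1
  have : (-((Real.pi : ℂ) / 2) * ∑ i, (Complex.normSq (z i) : ℂ)) =
    ((-(Real.pi / 2) * ∑ i, ‖z i‖ ^ 2 : ℝ) : ℂ) := by
    simp [Complex.normSq_eq_norm_sq]
  rw [this, Complex.ofReal_re]

lemma gauss_cont {n : ℕ} : Continuous (gaussFn : (Fin n → ℂ) → ℂ) := gauss_diff.continuous

lemma one_int (C : ℝ) :
    Integrable (fun z : ℂ => Real.exp (2 * C * ‖z‖ - Real.pi * ‖z‖ ^ 2)) volume := by
  have h := (GaussianFourier.integrable_cexp_neg_mul_sq_norm_add (b := 1) (V := ℂ) (by simp) 0 0).norm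
  refine (h.const_mul (Real.exp (C ^ 2))).mono' (Continuous.aestronglyMeasurable (by fun_prop)) ?_
  refine Filter.Eventually.of_forall fun z => ?_
  have e : ‖Complex.exp (-1 * (‖z‖ : ℂ) ^ 2 + 0 * ((inner ℝ (0 : ℂ) z : ℝ) : ℂ))‖ =
      Real.exp (-‖z‖ ^ 2) := by
    rw [Complex.norm_exp]
    congr 1
    rw [zero_mul, add_zero, neg_one_mul, ← Complex.ofReal_pow, ← Complex.ofReal_neg,
      Complex.ofReal_re]
  rw [e, ← Real.exp_add, Real.norm_eq_abs, Real.abs_exp]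
  apply Real.exp_le_exp.2
  nlinarith [sq_nonneg (C - ‖z‖), Real.pi_gt_three, sq_nonneg ‖z‖]

lemma weight_memLp {n : ℕ} (C : ℝ) :
    MemLp (fun z : Fin n → ℂ => Real.exp (C * sumNorm z) * ‖gaussFn z‖) 2 volume := by
  have hc : Continuous (fun z : Fin n → ℂ => Real.exp (C * sumNorm z) * ‖gaussFn z‖) := by
    have := gauss_cont (n := n)
    unfold sumNorm
    fun_prop
  rw [memLp_two_iff_integrable_sq_norm hc.aestronglyMeasurable]
  have := Integrable.fintype_prod (ι := Fin n) (μ := fun _ => (volume : Measure ℂ))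
    (f := fun _ z => Real.exp (2 * C * ‖z‖ - Real.pi * ‖z‖ ^ 2)) (fun _ => one_int C)
  rw [← volume_pi] at this
  convert! this using 2 with z
  rw [norm_mul, norm_norm, norm_gauss, Real.norm_eq_abs, Real.abs_exp, sumNorm, Finset.mul_sum,
    Real.exp_sum, ← Finset.prod_mul_distrib, ← Finset.prod_pow]
  refine Finset.prod_congr rfl fun i _ => ?_
  rw [← Real.exp_add, ← Real.exp_nat_mul]
  congr 1
  push_cast
  ring

lemma sumNorm_nonneg {n : ℕ} (z : Fin n → ℂ) : 0 ≤ sumNorm z :=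
  Finset.sum_nonneg fun _ _ => norm_nonneg _

lemma norm_pt_le {n : ℕ} (i : Fin n ⊕ Fin n) (z : Fin n → ℂ) : ‖pt z i‖ ≤ sumNorm z := by
  rcases i with k | k
  · exact Finset.single_le_sum (f := fun i => ‖z i‖) (fun _ _ => norm_nonneg _) (Finset.mem_univ k)
  · simp only [pt, Sum.elim_inr, RCLike.norm_conj]
    exact Finset.single_le_sum (f := fun i => ‖z i‖) (fun _ _ => norm_nonneg _) (Finset.mem_univ k)

lemma poly_bound {n : ℕ} (P : Poly n) :
    ∃ A C : ℝ, 0 ≤ A ∧ 0 ≤ C ∧ ∀ z, ‖eval (pt z) P‖ ≤ A * Real.exp (C * sumNorm z) := by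
  induction P using MvPolynomial.induction_on with
  | C a => exact ⟨‖a‖, 0, norm_nonneg _, le_rfl, fun z => by simp⟩
  | add p q hp hq =>
    obtain ⟨A, C, hA, hC, h⟩ := hp
    obtain ⟨A', C', hA', hC', h'⟩ := hq
    refine ⟨A + A', C + C', by positivity, by positivity, fun z => ?_⟩
    rw [map_add, add_mul]
    have := sumNorm_nonneg z
    refine (norm_add_le _ _).trans (add_le_add ((h z).trans ?_) ((h' z).trans ?_))
    · gcongr
      linarith
    · gcongr
      linarith
  | mul_X p i hp =>
    obtain ⟨A, C, hA, hC, h⟩ := hp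
    refine ⟨A, C + 1, hA, by positivity, fun z => ?_⟩
    rw [map_mul, eval_X, norm_mul, add_mul, Real.exp_add, ← mul_assoc, one_mul]
    have h2 : ‖pt z i‖ ≤ Real.exp (sumNorm z) := by
      have := Real.add_one_le_exp (sumNorm z)
      have := norm_pt_le i z
      linarith
    exact mul_le_mul (h z) h2 (norm_nonneg _) (by positivity)

lemma Phi_memLp {n : ℕ} (P : Poly n) : MemLp (Phi P) 2 volume := by
  obtain ⟨A, C, hA, hC, h⟩ := poly_bound P
  refine ((weight_memLp C).const_mul A).mono' ?_ ?_
  · exact ((poly_diff P).mul gauss_diff).continuous.aestronglyMeasurable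
  · refine Filter.Eventually.of_forall fun z => ?_
    rw [Phi, norm_mul, ← mul_assoc]
    exact mul_le_mul_of_nonneg_right (h z) (norm_nonneg _)

/-- A real linear functional as a polynomial. -/
def polyL {n : ℕ} (L : StrongDual ℝ (Fin n → ℂ)) : Poly n :=
  ∑ i, (C ((L (Pi.single i 1) : ℂ) / 2) * (X (Sum.inl i) + X (Sum.inr i)) +
    C ((L (Pi.single i Complex.I) : ℂ) / (2 * Complex.I)) * (X (Sum.inl i) - X (Sum.inr i)))

lemma L_eq {n : ℕ} (L : StrongDual ℝ (Fin n → ℂ)) (z : Fin n → ℂ) :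
    L z = ∑ i, ((z i).re * L (Pi.single i 1) + (z i).im * L (Pi.single i Complex.I)) := by
  have : z = ∑ i, ((z i).re • (Pi.single i (1 : ℂ) : Fin n → ℂ) +
      (z i).im • (Pi.single i Complex.I : Fin n → ℂ)) := by
    conv_lhs => rw [← Finset.univ_sum_single z]
    refine Finset.sum_congr rfl fun i _ => ?_
    rw [← Pi.single_smul, ← Pi.single_smul, ← Pi.single_add]
    congr 1
    simp [Complex.re_add_im]
  conv_lhs => rw [this]
  simp

lemma eval_polyL {n : ℕ} (L : StrongDual ℝ (Fin n → ℂ)) (z : Fin n → ℂ) :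
    eval (pt z) (polyL L) = (L z : ℂ) := by
  rw [L_eq, polyL]
  push_cast
  rw [map_sum]
  refine Finset.sum_congr rfl fun i _ => ?_
  simp only [map_add, map_sub, map_mul, eval_C, eval_X, pt, Sum.elim_inl, Sum.elim_inr]
  rw [Complex.re_eq_add_conj, Complex.im_eq_sub_conj]
  ring

lemma exists_L_bound {n : ℕ} (L : StrongDual ℝ (Fin n → ℂ)) (z : Fin n → ℂ) :
    |L z| ≤ ‖L‖ * sumNorm z := by
  refine (L.le_opNorm z).trans (mul_le_mul_of_nonneg_left ?_ (norm_nonneg _))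
  rw [pi_norm_le_iff_of_nonneg (sumNorm_nonneg z)]
  exact fun i => norm_pt_le (Sum.inl i) z

lemma expo_zero {n : ℕ} {v : (Fin n → ℂ) → ℂ} (hv : MemLp v 2 volume)
    (h : ∀ P : Poly n, ∫ z, v z * Phi P z = 0) (L : StrongDual ℝ (Fin n → ℂ)) :
    ∫ z, (v z * gaussFn z) * Complex.exp ((L z : ℂ) * Complex.I) = 0 := by
  have hs := hasSum_integral_of_dominated_convergence (μ := (volume : Measure (Fin n → ℂ)))
    (F := fun (k : ℕ) z => v z * Phi (C ((k.factorial : ℂ)⁻¹) * (polyL L * C Complex.I) ^ k) z)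
    (f := fun z => (v z * gaussFn z) * Complex.exp ((L z : ℂ) * Complex.I))
    (fun k z => (‖v z‖ * ‖gaussFn z‖) * (|L z| ^ k / k.factorial))
    (fun k => hv.1.mul (Phi_memLp _).1) ?_ ?_ ?_ ?_
  · simp only [h] at hs
    exact hs.unique hasSum_zero
  · refine fun k => Filter.Eventually.of_forall fun z => le_of_eq ?_
    simp only [Phi, norm_mul, map_mul, eval_C, map_pow, eval_polyL, norm_inv, norm_pow,
      Complex.norm_I, Complex.norm_real, Complex.norm_natCast, Real.norm_eq_abs]
    ring
  · refine Filter.Eventually.of_forall fun z => ?_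
    exact (Real.summable_pow_div_factorial _).mul_left _
  · have e : ∀ z : Fin n → ℂ, ∑' k : ℕ, (‖v z‖ * ‖gaussFn z‖) * (|L z| ^ k / k.factorial) =
        ‖v z‖ * (Real.exp |L z| * ‖gaussFn z‖) := by
      intro z
      rw [tsum_mul_left, (NormedSpace.expSeries_div_hasSum_exp (|L z|)).tsum_eq,
        ← Real.exp_eq_exp_ℝ]
      ring
    simp only [e]
    have hw : MemLp (fun z : Fin n → ℂ => Real.exp |L z| * ‖gaussFn z‖) 2 volume := by
      refine (weight_memLp ‖L‖).mono' ?_ ?_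
      · have := gauss_cont (n := n)
        exact Continuous.aestronglyMeasurable (by fun_prop)
      · refine Filter.Eventually.of_forall fun z => ?_
        rw [norm_mul, norm_norm, Real.norm_eq_abs, Real.abs_exp]
        gcongr
        exact exists_L_bound L z
    exact hv.norm.integrable_mul hw
  · refine Filter.Eventually.of_forall fun z => ?_
    have := (NormedSpace.expSeries_div_hasSum_exp ((L z : ℂ) * Complex.I)).mul_left
      (v z * gaussFn z)
    rw [← Complex.exp_eq_exp_ℂ] at this
    convert! this using 2 with k
    simp only [Phi, map_mul, eval_C, map_pow, eval_polyL]
    ring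

/-- The submodule of `L²` of classes represented by elements of a submodule of functions. -/
def repr {n : ℕ} (S : Submodule ℂ ((Fin n → ℂ) → ℂ)) :
    Submodule ℂ (Lp ℂ 2 (volume : Measure (Fin n → ℂ))) where
  carrier := {g | ∃ h ∈ S, (g : (Fin n → ℂ) → ℂ) =ᵐ[volume] h}
  zero_mem' := ⟨0, S.zero_mem, Lp.coeFn_zero _ _ _⟩
  add_mem' := by
    rintro a b ⟨h, hh, e⟩ ⟨h', hh', e'⟩
    exact ⟨h + h', S.add_mem hh hh', (Lp.coeFn_add a b).trans (e.add e')⟩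
  smul_mem' := by
    rintro c a ⟨h, hh, e⟩
    exact ⟨c • h, S.smul_mem c hh, (Lp.coeFn_smul c a).trans (e.const_smul c)⟩

lemma main {n : ℕ} (S : Submodule ℂ ((Fin n → ℂ) → ℂ)) (hS : ∀ P : Poly n, Phi P ∈ S) :
    Dense (repr S : Set (Lp ℂ 2 (volume : Measure (Fin n → ℂ)))) := by
  rw [Submodule.dense_iff_topologicalClosure_eq_top, Submodule.topologicalClosure_eq_top_iff,
    eq_bot_iff]
  intro g hg
  rw [Submodule.mem_orthogonal'] at hg
  have hv : MemLp (fun z => (starRingEnd ℂ) (g z)) 2 volume := by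
    refine (Lp.memLp g).of_le ?_ ?_
    · exact Complex.continuous_conj.comp_aestronglyMeasurable (Lp.memLp g).1
    · exact Filter.Eventually.of_forall fun z => by simp
  have h0 : ∀ P : Poly n, ∫ z, (starRingEnd ℂ) (g z) * Phi P z = 0 := by
    intro P
    have h1 := hg ((Phi_memLp P).toLp (Phi P)) ⟨Phi P, hS P, (Phi_memLp P).coeFn_toLp⟩
    rw [L2.inner_def] at h1
    rw [← h1]
    refine integral_congr_ae ?_
    filter_upwards [(Phi_memLp P).coeFn_toLp] with z hz
    rw [hz, RCLike.inner_apply, mul_comm]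
  have hg1 : MemLp (gaussFn : (Fin n → ℂ) → ℂ) 2 volume := by
    have := Phi_memLp (1 : Poly n)
    have e : Phi (1 : Poly n) = gaussFn := by funext z; simp [Phi]
    rwa [e] at this
  have hz := complex_zero (hv.integrable_mul hg1) (expo_zero hv h0)
  rw [Submodule.mem_bot, Lp.eq_zero_iff_ae_eq_zero]
  filter_upwards [hz] with z h
  have hne : gaussFn z ≠ 0 := Complex.exp_ne_zero _
  simpa [hne] using h

end EigDense

/-- The linear span of the family `{f_{α,β} : α, β ∈ ℕⁿ}` is dense in
`L²(ℂⁿ; ℂ)`. -/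
theorem eigFun_span_dense {n : ℕ} :
    Dense {g : Lp ℂ 2 (volume : Measure (Fin n → ℂ)) |
      ∃ h ∈ Submodule.span ℂ {f : (Fin n → ℂ) → ℂ | ∃ α β : Fin n → ℕ, f = eigFun α β},
        (g : (Fin n → ℂ) → ℂ) =ᵐ[volume] h} := by
  exact EigDense.main _ EigDense.Phi_mem
end
end

section
/- Let F, G : ℂ^n × ℂ^n → ℂ be polynomial functions in the underlying real coordinates of their arguments (equivalently, polynomials in the coordinates z_i, z̄_i of the first argument and z'_i, z̄'_i of the second). Then there exists a polynomial function K[F,G] : ℂ^n × ℂ^n → ℂ of the same type such that for all z, z' ∈ ℂ^n, ∫_{ℂ^n} F(z, w) 𝒫(z, w) G(w, z') 𝒫(w, z') dW = K[F,G](z, z') · 𝒫(z, z'). -/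
open MeasureTheory Complex

noncomputable section

/-- The one-dimensional Gaussian moment integrand. -/
def gm (k : ℕ) (c : ℂ) (x : ℝ) : ℂ :=
  (x : ℂ) ^ k * Complex.exp (-(Real.pi : ℂ) * (x : ℂ) ^ 2 + c * x)

lemma gm_cont (k : ℕ) (c : ℂ) : Continuous (gm k c) := by
  unfold gm; fun_prop

lemma gm_integrable (k : ℕ) : ∀ c : ℂ, Integrable (gm k c) := by
  induction k with
  | zero =>
    intro c
    have := integrable_cexp_quadratic (b := (Real.pi : ℂ)) (by simpa using Real.pi_pos) c 0
    refine this.congr (Filter.Eventually.of_forall fun x => ?_)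
    simp [gm]
  | succ k ih =>
    intro c
    refine Integrable.mono' ((ih (c + 1)).norm.add (ih (c - 1)).norm)
      (gm_cont _ _).aestronglyMeasurable (Filter.Eventually.of_forall fun x => ?_)
    have h1 : gm (k + 1) c x = x * gm k c x := by simp [gm]; ring
    have h2 : gm k (c + 1) x = Complex.exp ((x : ℝ) : ℂ) * gm k c x := by
      simp only [gm]
      rw [mul_left_comm, ← Complex.exp_add]; ring_nf
    have h3 : gm k (c - 1) x = Complex.exp ((-x : ℝ) : ℂ) * gm k c x := by
      simp only [gm]
      rw [mul_left_comm, ← Complex.exp_add]; push_cast; ring_nf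
    simp only [Pi.add_apply]
    rw [h1, h2, h3, norm_mul, norm_mul, norm_mul, Complex.norm_exp_ofReal, Complex.norm_exp_ofReal,
      ← add_mul]
    gcongr
    rw [Complex.norm_real, Real.norm_eq_abs]
    have e1 := Real.add_one_le_exp x
    have e2 := Real.add_one_le_exp (-x)
    have p1 := Real.exp_pos x
    have p2 := Real.exp_pos (-x)
    rw [abs_le]
    constructor <;> linarith

lemma gm_rec (k : ℕ) (c : ℂ) :
    (∫ x, gm (k + 1) c x) = (c / (2 * Real.pi)) * (∫ x, gm k c x)
      + (k / (2 * Real.pi)) * ∫ x, gm (k - 1) c x := by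
  have hd : ∀ x : ℝ, HasDerivAt (gm k c)
      (k * gm (k - 1) c x + (c * gm k c x + (-2 * Real.pi) * gm (k + 1) c x)) x := by
    intro x
    have h0 : HasDerivAt (fun y : ℂ => y ^ k * Complex.exp (-(Real.pi : ℂ) * y ^ 2 + c * y))
        (k * (x : ℂ) ^ (k - 1) * Complex.exp (-(Real.pi : ℂ) * (x : ℂ) ^ 2 + c * x) +
          (x : ℂ) ^ k * (Complex.exp (-(Real.pi : ℂ) * (x : ℂ) ^ 2 + c * x) *
            (-(Real.pi : ℂ) * (2 * x) + c * 1))) (x : ℂ) := by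
      refine (hasDerivAt_pow k (x : ℂ)).mul (HasDerivAt.cexp ?_)
      refine HasDerivAt.add ?_ ((hasDerivAt_id _).const_mul c)
      simpa using (hasDerivAt_pow 2 (x : ℂ)).const_mul (-(Real.pi : ℂ))
    convert! h0.comp_ofReal using 1
    simp only [gm]
    ring
  have i1 := (gm_integrable (k - 1) c).const_mul (k : ℂ)
  have i2 := (gm_integrable k c).const_mul c
  have i3 := (gm_integrable (k + 1) c).const_mul (-2 * (Real.pi : ℂ))
  have := integral_eq_zero_of_hasDerivAt_of_integrable hd (i1.add (i2.add i3)) (gm_integrable k c)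
  have i23 : Integrable (fun x => c * gm k c x + -2 * (Real.pi : ℂ) * gm (k + 1) c x) := i2.add i3
  rw [integral_add i1 i23, integral_add i2 i3, integral_const_mul, integral_const_mul,
    integral_const_mul] at this
  have hpi : (Real.pi : ℂ) ≠ 0 := by exact_mod_cast Real.pi_ne_zero
  field_simp
  linear_combination -this

lemma gm_integral (k : ℕ) : ∃ q : Polynomial ℂ, ∀ c : ℂ,
    (∫ x, gm k c x) = q.eval c * Complex.exp (c ^ 2 / (4 * Real.pi)) := by
  induction k using Nat.strong_induction_on with
  | _ k ih =>
    rcases k with _ | k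
    · refine ⟨Polynomial.C (((Real.pi : ℂ) / -(-(Real.pi : ℂ))) ^ (1 / 2 : ℂ)), fun c => ?_⟩
      have := integral_cexp_quadratic (b := -(Real.pi : ℂ)) (by simpa using Real.pi_pos) c 0
      simp only [gm, pow_zero, one_mul, Polynomial.eval_C]
      simp only [add_zero] at this
      rw [this]
      congr 2
      rw [mul_neg, div_neg]; ring
    · obtain ⟨q1, h1⟩ := ih k (by omega)
      obtain ⟨q2, h2⟩ := ih (k - 1) (by omega)
      refine ⟨Polynomial.C (1 / (2 * (Real.pi : ℂ))) * Polynomial.X * q1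
        + Polynomial.C (k / (2 * (Real.pi : ℂ))) * q2, fun c => ?_⟩
      rw [gm_rec, h1, h2]
      simp
      ring

/-- The one-variable integral over `ℂ`. -/
lemma gm_complex (a b : ℕ) (c d : ℂ) :
    Integrable (fun w : ℂ => gm a c w.re * gm b d w.im) ∧
    (∫ w : ℂ, gm a c w.re * gm b d w.im) = (∫ x, gm a c x) * ∫ y, gm b d y := by
  have hi : Integrable (fun p : ℝ × ℝ => gm a c p.1 * gm b d p.2) :=
    (gm_integrable a c).mul_prod (gm_integrable b d)
  constructor
  · exact Complex.volume_preserving_equiv_real_prod.integrable_comp_of_integrable hi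
  · rw [← integral_prod_mul]
    exact Complex.volume_preserving_equiv_real_prod.integral_comp
      Complex.measurableEquivRealProd.measurableEmbedding
      (fun p : ℝ × ℝ => gm a c p.1 * gm b d p.2)

lemma berg_fac {n : ℕ} (z z' w : Fin n → ℂ) (a b : Fin n → ℕ) :
    (∏ j, (((w j).re : ℂ) ^ a j * ((w j).im : ℂ) ^ b j)) * (bergK z w * bergK w z') =
    ∏ j, (Complex.exp (-((Real.pi : ℂ) / 2) *
        ((Complex.normSq (z j) : ℂ) + (Complex.normSq (z' j) : ℂ))) *
      (gm (a j) (Real.pi * (z j + (starRingEnd ℂ) (z' j))) (w j).re *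
       gm (b j) (Real.pi * Complex.I * ((starRingEnd ℂ) (z' j) - z j)) (w j).im)) := by
  simp only [bergK, gm]
  rw [← Complex.exp_add, Finset.mul_sum, Finset.mul_sum, ← Finset.sum_add_distrib, Complex.exp_sum,
    ← Finset.prod_mul_distrib]
  refine Finset.prod_congr rfl fun j _ => ?_
  have key : ∀ A B e1 e2 e3 e4 : ℂ, e1 = e2 + (e3 + e4) → (A * B) * Complex.exp e1 =
      Complex.exp e2 * ((A * Complex.exp e3) * (B * Complex.exp e4)) := by
    intro A B e1 e2 e3 e4 h
    rw [h, Complex.exp_add, Complex.exp_add]; ring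
  apply key
  generalize z j = s
  generalize z' j = t
  generalize w j = u
  have hu : u = u.re + u.im * Complex.I := (Complex.re_add_im u).symm
  have hu' : (starRingEnd ℂ) u = u.re - u.im * Complex.I := by
    apply Complex.ext <;> simp
  have hn : (Complex.normSq u : ℂ) = (u.re : ℂ) ^ 2 + (u.im : ℂ) ^ 2 := by
    rw [Complex.normSq_apply]; push_cast; ring
  rw [hn, hu']
  generalize (starRingEnd ℂ) t = t'
  have h2 : (2 : ℂ) * u * t' = 2 * (u.re + u.im * Complex.I) * t' := by rw [← hu]
  rw [h2]
  ring

lemma berg_self {n : ℕ} (z z' : Fin n → ℂ) :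
    bergK z z' = ∏ j, (Complex.exp (-((Real.pi : ℂ) / 2) *
        ((Complex.normSq (z j) : ℂ) + (Complex.normSq (z' j) : ℂ))) *
      (Complex.exp ((Real.pi * (z j + (starRingEnd ℂ) (z' j))) ^ 2 / (4 * Real.pi)) *
       Complex.exp ((Real.pi * Complex.I * ((starRingEnd ℂ) (z' j) - z j)) ^ 2
        / (4 * Real.pi)))) := by
  simp only [bergK]
  rw [Finset.mul_sum, Complex.exp_sum]
  refine Finset.prod_congr rfl fun j _ => ?_
  rw [← Complex.exp_add, ← Complex.exp_add]
  congr 1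
  have hpi : (Real.pi : ℂ) ≠ 0 := by exact_mod_cast Real.pi_ne_zero
  generalize (starRingEnd ℂ) (z' j) = t'
  simp only [mul_pow, Complex.I_sq]
  field_simp
  ring

/-- The evaluation point of polynomial kernels. -/
def pt {n : ℕ} (z z' : Fin n → ℂ) : Fin n ⊕ Fin n ⊕ Fin n ⊕ Fin n → ℂ :=
  Sum.elim (fun i => z i) (Sum.elim (fun i => (starRingEnd ℂ) (z i))
          (Sum.elim (fun i => z' i) (fun i => (starRingEnd ℂ) (z' i))))

lemma mono_int {n : ℕ} (a b : Fin n → ℕ) :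
    (∀ z z' : Fin n → ℂ, Integrable (fun w : Fin n → ℂ =>
      (∏ j, (((w j).re : ℂ) ^ a j * ((w j).im : ℂ) ^ b j)) * (bergK z w * bergK w z'))) ∧
    ∃ p : MvPolynomial (Fin n ⊕ Fin n ⊕ Fin n ⊕ Fin n) ℂ, ∀ z z' : Fin n → ℂ,
      (∫ w : Fin n → ℂ,
        (∏ j, (((w j).re : ℂ) ^ a j * ((w j).im : ℂ) ^ b j)) * (bergK z w * bergK w z'))
      = MvPolynomial.eval (pt z z') p * bergK z z' := by
  constructor
  · intro z z'
    simp only [berg_fac]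
    exact Integrable.fintype_prod (f := fun j (u : ℂ) =>
      Complex.exp (-((Real.pi : ℂ) / 2) *
        ((Complex.normSq (z j) : ℂ) + (Complex.normSq (z' j) : ℂ))) *
      (gm (a j) (Real.pi * (z j + (starRingEnd ℂ) (z' j))) u.re *
       gm (b j) (Real.pi * Complex.I * ((starRingEnd ℂ) (z' j) - z j)) u.im))
      (fun j => (gm_complex _ _ _ _).1.const_mul _)
  · choose q hq using gm_integral
    refine ⟨∏ j, (Polynomial.aeval (MvPolynomial.C (Real.pi : ℂ) *
        (MvPolynomial.X (Sum.inl j) + MvPolynomial.X (Sum.inr (Sum.inr (Sum.inr j))))) (q (a j)) *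
      Polynomial.aeval (MvPolynomial.C ((Real.pi : ℂ) * Complex.I) *
        (MvPolynomial.X (Sum.inr (Sum.inr (Sum.inr j))) - MvPolynomial.X (Sum.inl j))) (q (b j))),
      fun z z' => ?_⟩
    have hev : ∀ (r : MvPolynomial (Fin n ⊕ Fin n ⊕ Fin n ⊕ Fin n) ℂ) (f : Polynomial ℂ),
        MvPolynomial.eval (pt z z') (Polynomial.aeval r f) =
          f.eval (MvPolynomial.eval (pt z z') r) := by
      intro r f
      rw [← MvPolynomial.coe_aeval_eq_eval]
      simp only [RingHom.coe_coe]
      rw [← Polynomial.aeval_algHom_apply, Polynomial.coe_aeval_eq_eval]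
    simp only [berg_fac]
    rw [integral_fintype_prod_volume_eq_prod (f := fun j (u : ℂ) =>
      Complex.exp (-((Real.pi : ℂ) / 2) *
        ((Complex.normSq (z j) : ℂ) + (Complex.normSq (z' j) : ℂ))) *
      (gm (a j) (Real.pi * (z j + (starRingEnd ℂ) (z' j))) u.re *
       gm (b j) (Real.pi * Complex.I * ((starRingEnd ℂ) (z' j) - z j)) u.im)),
      berg_self, map_prod, ← Finset.prod_mul_distrib]
    refine Finset.prod_congr rfl fun j _ => ?_
    rw [integral_const_mul, (gm_complex _ _ _ _).2, hq, hq, map_mul, hev, hev]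
    simp [pt]
    ring

/-- The extended evaluation point, with the real and imaginary parts of `w`. -/
def pt6 {n : ℕ} (z z' w : Fin n → ℂ) : (Fin n ⊕ Fin n ⊕ Fin n ⊕ Fin n) ⊕ (Fin n ⊕ Fin n) → ℂ :=
  Sum.elim (pt z z') (Sum.elim (fun i => ((w i).re : ℂ)) (fun i => ((w i).im : ℂ)))

lemma poly_int {n : ℕ} (P : MvPolynomial ((Fin n ⊕ Fin n ⊕ Fin n ⊕ Fin n) ⊕ (Fin n ⊕ Fin n)) ℂ) :
    (∀ z z' : Fin n → ℂ, Integrable (fun w : Fin n → ℂ =>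
      MvPolynomial.eval (pt6 z z' w) P * (bergK z w * bergK w z'))) ∧
    ∃ p : MvPolynomial (Fin n ⊕ Fin n ⊕ Fin n ⊕ Fin n) ℂ, ∀ z z' : Fin n → ℂ,
      (∫ w : Fin n → ℂ, MvPolynomial.eval (pt6 z z' w) P * (bergK z w * bergK w z'))
      = MvPolynomial.eval (pt z z') p * bergK z z' := by
  induction P using MvPolynomial.induction_on' with
  | monomial u c =>
    have hm : ∀ z z' w : Fin n → ℂ, MvPolynomial.eval (pt6 z z' w) (MvPolynomial.monomial u c) *
        (bergK z w * bergK w z') = (c * ∏ i, pt z z' i ^ u (Sum.inl i)) *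
        ((∏ j, (((w j).re : ℂ) ^ u (Sum.inr (Sum.inl j)) * ((w j).im : ℂ) ^ u (Sum.inr (Sum.inr j))))
          * (bergK z w * bergK w z')) := by
      intro z z' w
      rw [MvPolynomial.eval_monomial, Finsupp.prod_fintype _ _ (by simp), Fintype.prod_sum_type,
        Fintype.prod_sum_type (fun x => pt6 z z' w (Sum.inr x) ^ u (Sum.inr x)),
        Finset.prod_mul_distrib]
      simp only [pt6, Sum.elim_inl, Sum.elim_inr]
      ring
    obtain ⟨h1, p, hp⟩ := mono_int (fun j => u (Sum.inr (Sum.inl j)))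
      (fun j => u (Sum.inr (Sum.inr j)))
    refine ⟨fun z z' => ?_, MvPolynomial.C c * (∏ i, MvPolynomial.X i ^ u (Sum.inl i)) * p,
      fun z z' => ?_⟩
    · simp only [hm]
      exact (h1 z z').const_mul _
    · simp only [hm]
      rw [integral_const_mul, hp]
      simp only [map_mul, map_prod, map_pow, MvPolynomial.eval_C, MvPolynomial.eval_X]
      ring
  | add P Q hP hQ =>
    obtain ⟨h1, p, hp⟩ := hP
    obtain ⟨h2, q, hq⟩ := hQ
    refine ⟨fun z z' => ?_, p + q, fun z z' => ?_⟩
    · simp only [map_add, add_mul]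
      exact (h1 z z').add (h2 z z')
    · simp only [map_add, add_mul]
      rw [integral_add (h1 z z') (h2 z z'), hp, hq]

/-- For polynomial kernels `F, G` there is a polynomial kernel `K[F,G]` with
`∫ F(z,w) 𝒫(z,w) G(w,z') 𝒫(w,z') dW = K[F,G](z,z') 𝒫(z,z')` for all `z, z'`. -/
theorem kernel_calculus_exists {n : ℕ} (F G : (Fin n → ℂ) → (Fin n → ℂ) → ℂ)
    (hF : IsPolyKernel F) (hG : IsPolyKernel G) :
    ∃ K : (Fin n → ℂ) → (Fin n → ℂ) → ℂ, IsPolyKernel K ∧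
      ∀ z z' : Fin n → ℂ,
        (∫ w : Fin n → ℂ, F z w * bergK z w * G w z' * bergK w z') = K z z' * bergK z z' := by
  obtain ⟨p, hp⟩ := hF
  obtain ⟨q, hq⟩ := hG
  let W : Fin n → MvPolynomial ((Fin n ⊕ Fin n ⊕ Fin n ⊕ Fin n) ⊕ (Fin n ⊕ Fin n)) ℂ := fun i =>
    MvPolynomial.X (Sum.inr (Sum.inl i)) + MvPolynomial.C Complex.I *
      MvPolynomial.X (Sum.inr (Sum.inr i))
  let W' : Fin n → MvPolynomial ((Fin n ⊕ Fin n ⊕ Fin n ⊕ Fin n) ⊕ (Fin n ⊕ Fin n)) ℂ := fun i =>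
    MvPolynomial.X (Sum.inr (Sum.inl i)) - MvPolynomial.C Complex.I *
      MvPolynomial.X (Sum.inr (Sum.inr i))
  let V : (Fin n ⊕ Fin n ⊕ Fin n ⊕ Fin n) →
      MvPolynomial ((Fin n ⊕ Fin n ⊕ Fin n ⊕ Fin n) ⊕ (Fin n ⊕ Fin n)) ℂ := fun i =>
    MvPolynomial.X (Sum.inl i)
  have hW : ∀ (z z' w : Fin n → ℂ) i, MvPolynomial.eval (pt6 z z' w) (W i) = w i := by
    intro z z' w i
    simp only [W, map_add, map_mul, MvPolynomial.eval_X, MvPolynomial.eval_C, pt6, Sum.elim_inr,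
      Sum.elim_inl]
    rw [mul_comm]; exact Complex.re_add_im _
  have hW' : ∀ (z z' w : Fin n → ℂ) i,
      MvPolynomial.eval (pt6 z z' w) (W' i) = (starRingEnd ℂ) (w i) := by
    intro z z' w i
    simp only [W', map_sub, map_mul, MvPolynomial.eval_X, MvPolynomial.eval_C, pt6, Sum.elim_inr,
      Sum.elim_inl]
    conv_rhs => rw [← Complex.re_add_im (w i)]
    simp [sub_eq_add_neg, mul_comm]
  have hV : ∀ (z z' w : Fin n → ℂ) i, MvPolynomial.eval (pt6 z z' w) (V i) = pt z z' i := by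
    intro z z' w i
    simp [V, pt6]
  let S : (Fin n ⊕ Fin n ⊕ Fin n ⊕ Fin n) →
      MvPolynomial ((Fin n ⊕ Fin n ⊕ Fin n ⊕ Fin n) ⊕ (Fin n ⊕ Fin n)) ℂ :=
    Sum.elim (fun i => V (Sum.inl i)) (Sum.elim (fun i => V (Sum.inr (Sum.inl i))) (Sum.elim W W'))
  let T : (Fin n ⊕ Fin n ⊕ Fin n ⊕ Fin n) →
      MvPolynomial ((Fin n ⊕ Fin n ⊕ Fin n ⊕ Fin n) ⊕ (Fin n ⊕ Fin n)) ℂ :=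
    Sum.elim W (Sum.elim W' (Sum.elim (fun i => V (Sum.inr (Sum.inr (Sum.inl i))))
      (fun i => V (Sum.inr (Sum.inr (Sum.inr i))))))
  have hbind : ∀ (z z' w : Fin n → ℂ) (R : (Fin n ⊕ Fin n ⊕ Fin n ⊕ Fin n) →
      MvPolynomial ((Fin n ⊕ Fin n ⊕ Fin n ⊕ Fin n) ⊕ (Fin n ⊕ Fin n)) ℂ) r,
      MvPolynomial.eval (pt6 z z' w) (MvPolynomial.bind₁ R r) =
        MvPolynomial.eval (fun i => MvPolynomial.eval (pt6 z z' w) (R i)) r := by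
    intro z z' w R r
    simp only [← MvPolynomial.coe_aeval_eq_eval, RingHom.coe_coe]
    rw [MvPolynomial.aeval_bind₁]
  have hFS : ∀ z z' w : Fin n → ℂ,
      F z w = MvPolynomial.eval (pt6 z z' w) (MvPolynomial.bind₁ S p) := by
    intro z z' w
    rw [hp, hbind]
    congr 2
    funext i
    rcases i with i | i | i | i <;> simp [S, hV, hW, hW', pt]
  have hGT : ∀ z z' w : Fin n → ℂ,
      G w z' = MvPolynomial.eval (pt6 z z' w) (MvPolynomial.bind₁ T q) := by
    intro z z' w
    rw [hq, hbind]
    congr 2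
    funext i
    rcases i with i | i | i | i <;> simp [T, hV, hW, hW', pt]
  obtain ⟨-, k, hk⟩ := poly_int (MvPolynomial.bind₁ S p * MvPolynomial.bind₁ T q)
  refine ⟨fun z z' => MvPolynomial.eval (pt z z') k, ⟨k, fun z z' => rfl⟩, fun z z' => ?_⟩
  rw [← hk]
  refine integral_congr_ae (Filter.Eventually.of_forall fun w => ?_)
  simp only [map_mul, ← hFS z z' w, ← hGT z z' w]
  ring
end
end
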